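/- Let (G, H, Π) be a partial λ-drawing, where G is an embedded proper level-planar graph, H is a subgraph of G with the induced embedding, and Π is a λ-drawing of H, and let v_ref be a fixed vertex of H. Let D be the digraph obtained from the constraint digraph D_G^λ by adding, for every vertex v of H, an arc (v, v_ref) of length Π(v_ref) − Π(v) and an arc (v_ref, v) of length −(Π(v_ref) − Π(v)). Then (G, H, Π) is λ-extendable if and only if D admits a distance labeling. -/

import Mathlib

/-- The point in the plane at which vertex `v` with x-coordinate `Γ v` is drawn:
levels serve as y-coordinates. -/
def levelPt {V : Type*} (Γ : V → ℝ) (lv : V → ℕ) (v : V) : ℝ × ℝ :=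
  (Γ v, (lv v : ℝ))

/-- The closed straight-line segment representing the edge `(u, v)`. -/
def edgeSeg {V : Type*} (Γ : V → ℝ) (lv : V → ℕ) (u v : V) : Set (ℝ × ℝ) :=
  segment ℝ (levelPt Γ lv u) (levelPt Γ lv v)

/-- A straight-line level drawing `Γ` of the level graph with edge relation `E` and level
assignment `lv` is level-planar if any point lying on the segments of two distinct edges
is a common endpoint of the two segments. -/
def LevelPlanar {V : Type*} (E : V → V → Prop) (Γ : V → ℝ) (lv : V → ℕ) : Prop :=
  ∀ u v w x, E u v → E w x → (u, v) ≠ (w, x) →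
    ∀ p, p ∈ edgeSeg Γ lv u v → p ∈ edgeSeg Γ lv w x →
      (p = levelPt Γ lv u ∨ p = levelPt Γ lv v) ∧ (p = levelPt Γ lv w ∨ p = levelPt Γ lv x)

/-- The slope of the edge `(u, v)` in the drawing `Γ`. -/
noncomputable def slopeOf {V : Type*} (Γ : V → ℝ) (lv : V → ℕ) (u v : V) : ℝ :=
  (Γ v - Γ u) / ((lv v : ℝ) - (lv u : ℝ))

/-- The integer `xbar` is a gap in the integer-coordinate drawing `Γ`. -/
def IsGap {V : Type*} (E : V → V → Prop) (Γ : V → ℤ) (xbar : ℤ) : Prop :=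
  (∀ v, Γ v ≠ xbar) ∧ (∃ v₁, Γ v₁ < xbar) ∧ (∃ v₂, xbar < Γ v₂) ∧
    ∀ u v, E u v → ¬ (min (Γ u) (Γ v) < xbar ∧ xbar < max (Γ u) (Γ v))

/-- A drawing is compact if it has no gap. -/
def CompactDrawing {V : Type*} (E : V → V → Prop) (Γ : V → ℤ) : Prop :=
  ¬ ∃ xbar : ℤ, IsGap E Γ xbar

/-- `emb` is an embedding of the proper level graph `(E, lv)`: a family of total orders, one
on each level, such that no two edges interleave. -/
structure IsLevelEmbedding {V : Type*} (E : V → V → Prop) (lv : V → ℕ)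
    (emb : V → V → Prop) : Prop where
  same_level : ∀ u v, emb u v → lv u = lv v
  irrefl : ∀ u, ¬ emb u u
  trans : ∀ u v w, emb u v → emb v w → emb u w
  total : ∀ u v, lv u = lv v → u ≠ v → emb u v ∨ emb v u
  no_interleave : ∀ u v w x, E u w → E v x → emb u v → ¬ emb x w

/-- `u` and `v` are consecutive vertices on a common level: `u ≺ v` and no vertex lies
strictly between them. -/
def ConsecVert {V : Type*} (emb : V → V → Prop) (u v : V) : Prop :=
  emb u v ∧ ¬ ∃ z, emb u z ∧ emb z v

/-- `Γ` is a λ-drawing of the embedded proper level-planar graph `(E, lv, emb)`: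
an embedding-preserving level-planar straight-line level drawing with integer x-coordinates
in which every edge has slope in `{0, 1, …, λ - 1}`. -/
def IsLamDrawing {V : Type*} (E : V → V → Prop) (lv : V → ℕ) (emb : V → V → Prop)
    (lam : ℕ) (Γ : V → ℤ) : Prop :=
  (∀ u v, lv u = lv v → (emb u v ↔ Γ u < Γ v)) ∧
  (∀ u v, E u v → 0 ≤ Γ v - Γ u ∧ Γ v - Γ u ≤ (lam : ℤ) - 1) ∧
  LevelPlanar E (fun v => (Γ v : ℝ)) lv

/-- `x` is a distance labeling of the constraint digraph `D_G^λ`: for every arc `(a, b)` of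
length `ℓ` we have `x b ≤ x a + ℓ`.  The arcs are: `(u, v)` of length `λ - 1` and `(v, u)` of
length `0` for every edge `(u, v)`, and `(v, u)` of length `-1` for consecutive `u ≺ v`. -/
def IsDistanceLabeling {V : Type*} (E : V → V → Prop) (emb : V → V → Prop)
    (lam : ℕ) (x : V → ℤ) : Prop :=
  (∀ u v, E u v → x v ≤ x u + ((lam : ℤ) - 1) ∧ x u ≤ x v + 0) ∧
  (∀ u v, ConsecVert emb u v → x u ≤ x v + (-1))

/-- Directed walks in the constraint digraph `D_G^λ`, recording the start vertex, the end
vertex, the number of arcs, and the total arc length. -/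
inductive DWalk {V : Type*} (E : V → V → Prop) (emb : V → V → Prop) (lam : ℕ) :
    V → V → ℕ → ℤ → Prop
  | refl (v : V) : DWalk E emb lam v v 0 0
  | edgeFwd {u v w : V} {n : ℕ} {L : ℤ} :
      DWalk E emb lam u v n L → E v w → DWalk E emb lam u w (n + 1) (L + ((lam : ℤ) - 1))
  | edgeBack {u v w : V} {n : ℕ} {L : ℤ} :
      DWalk E emb lam u v n L → E w v → DWalk E emb lam u w (n + 1) (L + 0)
  | consecArc {u v w : V} {n : ℕ} {L : ℤ} :
      DWalk E emb lam u v n L → ConsecVert emb w v → DWalk E emb lam u w (n + 1) (L + (-1))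

/-- The constraint digraph `D_G^λ` contains no directed cycle of negative total length. -/
def NoNegCycle {V : Type*} (E : V → V → Prop) (emb : V → V → Prop) (lam : ℕ) : Prop :=
  ¬ ∃ (v : V) (n : ℕ) (L : ℤ), 0 < n ∧ DWalk E emb lam v v n L ∧ L < 0

/-- A point on the segment of an edge spanning one level, in coordinates. -/
theorem mem_edgeSeg_iff {V : Type*} {Γ : V → ℝ} {lv : V → ℕ} {u v : V}
    (h : lv v = lv u + 1) (p : ℝ × ℝ) :
    p ∈ edgeSeg Γ lv u v ↔
      ∃ t : ℝ, 0 ≤ t ∧ t ≤ 1 ∧ p = (Γ u + t * (Γ v - Γ u), (lv u : ℝ) + t) := by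
  simp only [edgeSeg, segment_eq_image', levelPt, Set.mem_image, Set.mem_Icc, h]
  constructor
  · rintro ⟨t, ⟨h0, h1⟩, rfl⟩
    exact ⟨t, h0, h1, by ext <;> simp⟩
  · rintro ⟨t, h0, h1, rfl⟩
    exact ⟨t, ⟨h0, h1⟩, by ext <;> simp⟩

/-- Two distinct edges between the same two levels whose endpoints are placed in weakly
increasing order on both levels can meet only at a common endpoint. -/
theorem param_eq_zero_or_one {a b c d t : ℝ} (h0 : 0 ≤ t) (h1 : t ≤ 1)
    (hac : a ≤ c) (hbd : b ≤ d) (hne : a < c ∨ b < d)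
    (h : a + t * (b - a) = c + t * (d - c)) : t = 0 ∨ t = 1 := by
  by_contra! hcon
  have ht0 : 0 < t := lt_of_le_of_ne h0 hcon.1.symm
  have ht1 : 0 < 1 - t := sub_pos.mpr (lt_of_le_of_ne h1 hcon.2)
  rcases hne with hne | hne
  · nlinarith [mul_pos ht1 (sub_pos.mpr hne), mul_nonneg h0 (sub_nonneg.mpr hbd)]
  · nlinarith [mul_pos ht0 (sub_pos.mpr hne), mul_nonneg ht1.le (sub_nonneg.mpr hac)]

/-- An embedding-preserving straight-line drawing of an embedded proper level graph is
level-planar. -/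
theorem levelPlanar_of_preserves_embedding {V : Type*} {E : V → V → Prop} {lv : V → ℕ}
    (hE : ∀ u v, E u v → lv v = lv u + 1) {emb : V → V → Prop}
    (hemb : IsLevelEmbedding E lv emb) {Γ : V → ℝ} (hΓ : ∀ u v, emb u v → Γ u < Γ v) :
    LevelPlanar E Γ lv := by
  intro u v w x huv hwx hne p hp hq
  have lvv := hE u v huv
  have lvx := hE w x hwx
  obtain ⟨s, hs0, hs1, rfl⟩ := (mem_edgeSeg_iff lvv p).1 hp
  obtain ⟨t, ht0, ht1, heq⟩ := (mem_edgeSeg_iff lvx _).1 hq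
  obtain ⟨hx, hy⟩ := Prod.mk.inj heq
  have key : (s = 0 ∨ s = 1) ∧ (t = 0 ∨ t = 1) := by
    rcases lt_trichotomy (lv u) (lv w) with hl | hl | hl
    · have : (lv u : ℝ) + 1 ≤ lv w := by exact_mod_cast hl
      exact ⟨Or.inr (by linarith), Or.inl (by linarith)⟩
    · have hst : s = t := by rw [hl] at hy; linarith
      subst hst
      suffices hs : s = 0 ∨ s = 1 from ⟨hs, hs⟩
      have mono : ∀ {a b c d}, E a b → E c d → emb a c → Γ b ≤ Γ d := by
        intro a b c d hab hcd hac
        by_cases hbd : b = d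
        · rw [hbd]
        · have hlv : lv b = lv d := by
            rw [hE a b hab, hE c d hcd, hemb.same_level a c hac]
          exact (hΓ b d ((hemb.total b d hlv hbd).resolve_right
            (hemb.no_interleave a c b d hab hcd hac))).le
      by_cases huw : u = w
      · subst huw
        have hvx : v ≠ x := fun h => hne (by rw [h])
        rcases hemb.total v x (by omega) hvx with h | h
        · exact param_eq_zero_or_one hs0 hs1 le_rfl (hΓ _ _ h).le (Or.inr (hΓ _ _ h)) hx
        · exact param_eq_zero_or_one hs0 hs1 le_rfl (hΓ _ _ h).le (Or.inr (hΓ _ _ h)) hx.symm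
      · rcases hemb.total u w hl huw with h | h
        · exact param_eq_zero_or_one hs0 hs1 (hΓ _ _ h).le (mono huv hwx h)
            (Or.inl (hΓ _ _ h)) hx
        · exact param_eq_zero_or_one hs0 hs1 (hΓ _ _ h).le (mono hwx huv h)
            (Or.inl (hΓ _ _ h)) hx.symm
    · have : (lv w : ℝ) + 1 ≤ lv u := by exact_mod_cast hl
      exact ⟨Or.inl (by linarith), Or.inr (by linarith)⟩
  constructor
  · rcases key.1 with rfl | rfl
    · left; simp [levelPt]
    · right; simp [levelPt, lvv]
  · rw [heq]
    rcases key.2 with rfl | rfl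
    · left; simp [levelPt]
    · right; simp [levelPt, lvx]

/-- A labeling that increases along consecutive vertices increases along the whole level. -/
theorem lt_of_emb_of_consecVert {V : Type*} [Finite V] {emb : V → V → Prop}
    (hirr : ∀ u, ¬ emb u u) (htrans : ∀ u v w, emb u v → emb v w → emb u w) {x : V → ℤ}
    (hx : ∀ u v, ConsecVert emb u v → x u < x v) {u v : V} (huv : emb u v) : x u < x v := by
  have : IsTrans V emb := ⟨htrans⟩
  have : Std.Irrefl emb := ⟨hirr⟩
  have wf : WellFounded emb := Finite.wellFounded_of_trans_of_irrefl emb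
  have wf' : WellFounded (Function.swap emb) := Finite.wellFounded_of_trans_of_irrefl _
  induction v using wf.induction generalizing u with
  | _ v ih =>
    -- the last vertex `z` with `u ≼ z ≺ v` is the predecessor of `v`
    obtain ⟨z, ⟨hz, hzv⟩, hmax⟩ :=
      wf'.has_min {z | (z = u ∨ emb u z) ∧ emb z v} ⟨u, Or.inl rfl, huv⟩
    have hcons : x z < x v := by
      refine hx z v ⟨hzv, ?_⟩
      rintro ⟨y, hzy, hyv⟩
      refine hmax y ⟨Or.inr ?_, hyv⟩ hzy
      rcases hz with rfl | hz
      · exact hzy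
      · exact htrans u z y hz hzy
    rcases hz with rfl | hz
    · exact hcons
    · exact (ih z hzv hz).trans hcons

/-- Let `(G, H, Pd)` be a partial λ-drawing (`H` the subgraph of `G` with
vertex set `S`, edge relation `EH` and induced embedding, `Pd` a λ-drawing of `H`), and let
`vref ∈ S`.  Let `D` be the constraint digraph `D_G^λ` augmented, for every vertex `v` of
`H`, by an arc `(v, vref)` of length `Pd vref - Pd v` and an arc `(vref, v)` of length
`-(Pd vref - Pd v)`.  Then `(G, H, Pd)` is λ-extendable if and only if `D` admits a
distance labeling. -/
theorem statement10 {V : Type*} [Fintype V] (E : V → V → Prop) (lv : V → ℕ)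
    (hE : ∀ u v, E u v → lv v = lv u + 1)
    (emb : V → V → Prop) (hemb : IsLevelEmbedding E lv emb)
    (lam : ℕ) (hlam : 1 ≤ lam)
    (S : Set V) (EH : V → V → Prop)
    (hEH : ∀ u v, EH u v → E u v ∧ u ∈ S ∧ v ∈ S)
    (Pd : S → ℤ)
    (hPd : IsLamDrawing (fun u v : S => EH u v) (fun v : S => lv v)
            (fun u v : S => emb u v) lam Pd)
    (vref : V) (hvref : vref ∈ S) :
    (∃ Γ : V → ℤ, IsLamDrawing E lv emb lam Γ ∧ ∀ v : V, ∀ hv : v ∈ S, Γ v = Pd ⟨v, hv⟩) ↔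
    (∃ x : V → ℤ, IsDistanceLabeling E emb lam x ∧
        ∀ v : V, ∀ hv : v ∈ S,
          x vref ≤ x v + (Pd ⟨vref, hvref⟩ - Pd ⟨v, hv⟩) ∧
          x v ≤ x vref + (-(Pd ⟨vref, hvref⟩ - Pd ⟨v, hv⟩))) := by
  constructor
  · rintro ⟨Γ, ⟨hord, hslope, -⟩, hext⟩
    refine ⟨Γ, ⟨fun u v huv => ?_, fun u v huv => ?_⟩, fun v hv => ?_⟩
    · have := hslope u v huv
      omega
    · have := (hord u v (hemb.same_level u v huv.1)).1 huv.1
      omega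
    · rw [hext v hv, hext vref hvref]
      omega
  · rintro ⟨x, ⟨hedge, hcons⟩, href⟩
    have hlt : ∀ u v, emb u v → x u < x v := fun u v huv =>
      lt_of_emb_of_consecVert hemb.irrefl hemb.trans
        (fun a b hab => by have := hcons a b hab; omega) huv
    refine ⟨fun v => x v - x vref + Pd ⟨vref, hvref⟩, ⟨fun u v hl => ⟨fun h => ?_, fun h => ?_⟩,
      fun u v huv => ?_, levelPlanar_of_preserves_embedding hE hemb fun u v huv => ?_⟩,
      fun v hv => ?_⟩
    · have := hlt u v h
      beta_reduce
      omega
    · have hne : u ≠ v := by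
        rintro rfl
        exact lt_irrefl _ h
      refine (hemb.total u v hl hne).resolve_right fun hvu => ?_
      have := hlt v u hvu
      beta_reduce at h
      omega
    · have := hedge u v huv
      beta_reduce
      omega
    · have := hlt u v huv
      exact_mod_cast (by omega : x u - x vref + Pd ⟨vref, hvref⟩ < x v - x vref + Pd ⟨vref, hvref⟩)
    · have := href v hv
      show x v - x vref + Pd ⟨vref, hvref⟩ = Pd ⟨v, hv⟩
      omega
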